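/- Let A and B be symmetric real d×d matrices. Then sup_{v ∈ K(2s)} |vᵀ(A ⊙ B)v| ≤ (sup_{v ∈ K(2s)} |vᵀAv|) · (sup_{v ∈ K(2s)} |vᵀBv|); that is, ‖A ⊙ B‖_s ≤ ‖A‖_s · ‖B‖_s. (Lemma C.1, inequality (C.1): submultiplicativity of the sparse quadratic-form norm under the Hadamard product.) -/

import Mathlib

open Matrix

/-- The sparse quadratic-form "norm" `‖A‖ₛ = sup_{v ∈ K(2s)} |vᵀAv|`, where
`K(2s)` is the set of vectors of Euclidean norm at most one with at most `2s`
nonzero coordinates. -/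
noncomputable def sparseSup (d s : ℕ) (A : Matrix (Fin d) (Fin d) ℝ) : ℝ :=
  sSup {x : ℝ | ∃ v : Fin d → ℝ, (∑ i, v i ^ 2) ≤ 1 ∧
    (Function.support v).ncard ≤ 2 * s ∧ x = |v ⬝ᵥ A.mulVec v|}

lemma sparseSup_nonneg (d s : ℕ) (A : Matrix (Fin d) (Fin d) ℝ) : 0 ≤ sparseSup d s A := by
  apply Real.sSup_nonneg
  rintro x ⟨v, -, -, rfl⟩
  exact abs_nonneg _

lemma bddAbove_sparse_quadratic_values (d s : ℕ) (A : Matrix (Fin d) (Fin d) ℝ) :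
    BddAbove {x : ℝ | ∃ v : Fin d → ℝ, (∑ i, v i ^ 2) ≤ 1 ∧
      (Function.support v).ncard ≤ 2 * s ∧ x = |v ⬝ᵥ A.mulVec v|} := by
  refine ⟨∑ i, ∑ j, |A i j|, ?_⟩
  rintro x ⟨v, hv, -, rfl⟩
  have h1 : ∀ i, |v i| ≤ 1 := fun i => by
    have := Finset.single_le_sum (f := fun i => v i ^ 2) (fun i _ => sq_nonneg (v i))
      (Finset.mem_univ i)
    exact (sq_le_one_iff_abs_le_one _).1 (this.trans hv)
  simp only [dotProduct, mulVec, Finset.mul_sum]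
  refine (Finset.abs_sum_le_sum_abs _ _).trans (Finset.sum_le_sum fun i _ => ?_)
  refine (Finset.abs_sum_le_sum_abs _ _).trans (Finset.sum_le_sum fun j _ => ?_)
  rw [abs_mul, abs_mul]
  have h2 : |A i j| * |v j| ≤ |A i j| := mul_le_of_le_one_right (abs_nonneg _) (h1 j)
  exact (mul_le_of_le_one_left (by positivity) (h1 i)).trans h2

lemma abs_quadratic_le_sparseSup (d s : ℕ) (A : Matrix (Fin d) (Fin d) ℝ) (v : Fin d → ℝ)
    (hs : (Function.support v).ncard ≤ 2 * s) :
    |v ⬝ᵥ A.mulVec v| ≤ sparseSup d s A * ∑ i, v i ^ 2 := by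
  have hn : 0 ≤ ∑ i, v i ^ 2 := Finset.sum_nonneg fun i _ => sq_nonneg (v i)
  rcases hn.eq_or_lt with h0 | hpos
  · have hv : v = 0 := by
      funext i
      have := (Finset.sum_eq_zero_iff_of_nonneg fun i _ => sq_nonneg (v i)).1 h0.symm i
        (Finset.mem_univ i)
      simpa using this
    simp [hv]
  · set n := ∑ i, v i ^ 2 with hndef
    have hc : (√n)⁻¹ ^ 2 = n⁻¹ := by rw [inv_pow, Real.sq_sqrt hn]
    have h : |((√n)⁻¹ • v) ⬝ᵥ A.mulVec ((√n)⁻¹ • v)| ≤ sparseSup d s A := by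
      refine le_csSup (bddAbove_sparse_quadratic_values d s A) ⟨_, ?_, ?_, rfl⟩
      · simp only [Pi.smul_apply, smul_eq_mul, mul_pow, ← Finset.mul_sum, hc]
        rw [← hndef, inv_mul_cancel₀ hpos.ne']
      · exact (Set.ncard_le_ncard (Function.support_const_smul_subset _ v)
          (Set.toFinite _)).trans hs
    rw [mulVec_smul, dotProduct_smul, smul_dotProduct, smul_smul, ← sq, hc, smul_eq_mul,
      abs_mul, abs_of_pos (inv_pos.2 hpos), inv_mul_le_iff₀ hpos] at h
    linarith

lemma sum_sq_column_le_sparseSup_sq (d s : ℕ) (A : Matrix (Fin d) (Fin d) ℝ)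
    (hA : A.IsSymm) (S : Finset (Fin d)) (hS : S.card ≤ 2 * s) (j : Fin d) (hj : j ∈ S) :
    ∑ i ∈ S, A i j ^ 2 ≤ sparseSup d s A ^ 2 := by
  set a := sparseSup d s A
  set n := ∑ i ∈ S, A i j ^ 2 with hndef
  have hn : 0 ≤ n := Finset.sum_nonneg fun i _ => sq_nonneg _
  set u : Fin d → ℝ := fun i => if i ∈ S then A i j else 0 with hu
  set e : Fin d → ℝ := Pi.single j 1 with he
  have hq : ∀ t : ℝ, |(u + t • e) ⬝ᵥ A.mulVec (u + t • e)| ≤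
      a * ∑ i, (u + t • e) i ^ 2 := fun t => by
    apply abs_quadratic_le_sparseSup
    refine le_trans ?_ hS
    rw [← Set.ncard_coe_finset]
    refine Set.ncard_le_ncard (fun i hi => ?_) (Set.toFinite _)
    by_contra hiS
    have hiS' : i ∉ S := hiS
    have hij : i ≠ j := fun h => hiS' (h ▸ hj)
    exact hi (by simp [hu, he, hiS', hij])
  have huu : ∑ i, u i ^ 2 = n := by
    simp [hu, hndef, ite_pow, Finset.sum_ite_mem]
  have huA : u ⬝ᵥ A.mulVec e = n := by
    simp [hu, he, hndef, dotProduct, Finset.sum_ite_mem, sq]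
  have hAu : e ⬝ᵥ A.mulVec u = n := by
    rw [dotProduct_mulVec, ← mulVec_transpose, hA.eq, dotProduct_comm, huA]
  have hnorm : ∀ t : ℝ, ∑ i, (u + t • e) i ^ 2 = n + 2 * t * u j + t ^ 2 := fun t => by
    have : ∀ i, (u + t • e) i ^ 2 =
        u i ^ 2 + (if i = j then 2 * t * u i + t ^ 2 else 0) := fun i => by
      by_cases h : i = j
      · subst h; simp [he]; ring
      · simp [he, h]
    simp only [this, Finset.sum_add_distrib, huu]
    simp; ring
  have hquad : ∀ t : ℝ, (u + t • e) ⬝ᵥ A.mulVec (u + t • e) =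
      u ⬝ᵥ A.mulVec u + 2 * t * n + t ^ 2 * A j j := fun t => by
    simp only [mulVec_add, mulVec_smul, dotProduct_add, add_dotProduct, smul_dotProduct,
      dotProduct_smul, huA, hAu, smul_eq_mul]
    simp [he]; ring
  have hp := (abs_le.1 (hq (√n))).2
  have hm := (abs_le.1 (hq (-√n))).1
  rw [hnorm, hquad] at hp hm
  have hsq := Real.sq_sqrt hn
  rw [neg_sq] at hm
  rw [hsq] at hp hm
  have hs0 := Real.sqrt_nonneg n
  rcases hn.eq_or_lt with h0 | hpos
  · rw [← h0]; positivity
  · have h : √n * n ≤ a * n := by linarith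
    have := le_of_mul_le_mul_right h hpos
    rw [← hsq]
    exact pow_le_pow_left₀ hs0 this 2

theorem stmt5 (d s : ℕ) (A B : Matrix (Fin d) (Fin d) ℝ)
    (hA : A.IsSymm) (hB : B.IsSymm) :
    sparseSup d s (A.hadamard B) ≤ sparseSup d s A * sparseSup d s B := by
  have ha := sparseSup_nonneg d s A
  have hb := sparseSup_nonneg d s B
  refine Real.sSup_le ?_ (mul_nonneg ha hb)
  rintro x ⟨v, hv, hs, rfl⟩
  set S : Finset (Fin d) := {i | v i ≠ 0} with hSdef
  have hS : S.card ≤ 2 * s := by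
    rw [← Set.ncard_coe_finset]
    convert hs using 2
    ext i; simp [hSdef]
  have hvS : ∑ i ∈ S, v i ^ 2 ≤ 1 :=
    (Finset.sum_le_univ_sum_of_nonneg fun i => sq_nonneg (v i)).trans hv
  have hout : ∀ i, i ∉ S → v i = 0 := fun i hi => by simpa [hSdef] using hi
  have heq : v ⬝ᵥ (A.hadamard B).mulVec v =
      ∑ p ∈ S ×ˢ S, (A p.1 p.2 * v p.2) * (B p.1 p.2 * v p.1) := by
    rw [Finset.sum_product]
    simp only [dotProduct, mulVec, hadamard_apply, Finset.mul_sum]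
    rw [← Finset.sum_subset (Finset.subset_univ S) fun i _ hi => by simp [hout i hi]]
    refine Finset.sum_congr rfl fun i _ => ?_
    rw [← Finset.sum_subset (Finset.subset_univ S) fun j _ hj => by simp [hout j hj]]
    exact Finset.sum_congr rfl fun j _ => by ring
  have key : ∀ M : Matrix (Fin d) (Fin d) ℝ, M.IsSymm →
      ∑ j ∈ S, ∑ i ∈ S, (M i j * v j) ^ 2 ≤ sparseSup d s M ^ 2 := fun M hM => by
    calc ∑ j ∈ S, ∑ i ∈ S, (M i j * v j) ^ 2
        ≤ ∑ j ∈ S, sparseSup d s M ^ 2 * v j ^ 2 := by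
          refine Finset.sum_le_sum fun j hj => ?_
          simp only [mul_pow, ← Finset.sum_mul]
          exact mul_le_mul_of_nonneg_right
            (sum_sq_column_le_sparseSup_sq d s M hM S hS j hj) (sq_nonneg _)
      _ ≤ sparseSup d s M ^ 2 := by
          rw [← Finset.mul_sum]
          exact mul_le_of_le_one_right (sq_nonneg _) hvS
  have hAs := key A hA
  rw [← Finset.sum_product_right' S S fun i j => (A i j * v j) ^ 2] at hAs
  have hBs' : ∑ p ∈ S ×ˢ S, (B p.1 p.2 * v p.1) ^ 2 ≤ sparseSup d s B ^ 2 := by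
    rw [Finset.sum_product]
    refine le_of_eq_of_le ?_ (key B hB)
    exact Finset.sum_congr rfl fun i _ => Finset.sum_congr rfl fun j _ => by rw [hB.apply i j]
  rw [heq]
  refine abs_le_of_sq_le_sq ?_ (mul_nonneg ha hb)
  rw [mul_pow]
  exact (Finset.sum_mul_sq_le_sq_mul_sq _ _ _).trans
    (mul_le_mul hAs hBs' (Finset.sum_nonneg fun _ _ => sq_nonneg _) (sq_nonneg _))
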